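/- arXiv:gr-qc/0505004 — 4 statements merged into one kernel-verified Lean document; each statement's English description precedes it below -/
import Mathlib

section
/- Consider the three-branch family (G_r(A₁),A₁): take the state space X = ℝ ⊕ ℝ ⊕ ℝ (three copies of ℝ), parameter space U = ℝ² with coordinates (u_x,u_z), and F given on the three branches by x² + u_x + u_z, x² − u_x + u_z, and x², respectively. Then the Maxwell set of F equals {(u_x,u_z) : u_x = 0 and u_z < 0} ∪ {(u_x,u_z) : |u_x| = u_z}. -/
/-- `x` is a global minimum point of the function `F (·, u)`. -/
def IsGlobalMinPt {X U : Type*} (F : X × U → ℝ) (u : U) (x : X) : Prop :=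
  ∀ y : X, F (x, u) ≤ F (y, u)

/-- The Maxwell set of a family `F`: those parameters `u` for which `F (·, u)`
has at least two distinct global minimum points. -/
def MaxwellSet {X U : Type*} (F : X × U → ℝ) : Set U :=
  {u : U | ∃ x₁ x₂ : X, x₁ ≠ x₂ ∧ IsGlobalMinPt F u x₁ ∧ IsGlobalMinPt F u x₂}

/-- The three-branch family `(G_r(A₁), A₁)`: `x² + u_x + u_z`, `x² − u_x + u_z`
and `x²` on the three branches; parameters `(u_x, u_z)`. -/
noncomputable def familyGrA1A1 : (ℝ ⊕ ℝ ⊕ ℝ) × (ℝ × ℝ) → ℝ :=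
  fun p =>
    Sum.elim (fun x : ℝ => x ^ 2 + p.2.1 + p.2.2)
      (Sum.elim (fun x : ℝ => x ^ 2 - p.2.1 + p.2.2) (fun x : ℝ => x ^ 2)) p.1

/-- A point on the first branch is a global minimum point iff it is the vertex of that branch and
the value there is at most the critical values of the other branches. -/
theorem isGlobalMinPt_familyGrA1A1_inl (u : ℝ × ℝ) (x : ℝ) :
    IsGlobalMinPt familyGrA1A1 u (.inl x) ↔ x = 0 ∧ u.1 ≤ 0 ∧ u.1 + u.2 ≤ 0 := by
  simp only [IsGlobalMinPt, familyGrA1A1, Sum.forall, Sum.elim_inl, Sum.elim_inr]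
  constructor
  · rintro ⟨h₁, h₂, h₃⟩
    have hx : x = 0 := by nlinarith [h₁ 0]
    subst hx
    exact ⟨rfl, by linarith [h₂ 0], by linarith [h₃ 0]⟩
  · rintro ⟨rfl, h₁, h₂⟩
    refine ⟨fun y => ?_, fun y => ?_, fun y => ?_⟩ <;> nlinarith [sq_nonneg y]

/-- The analogue of `isGlobalMinPt_familyGrA1A1_inl` for the second branch. -/
theorem isGlobalMinPt_familyGrA1A1_inr_inl (u : ℝ × ℝ) (x : ℝ) :
    IsGlobalMinPt familyGrA1A1 u (.inr (.inl x)) ↔ x = 0 ∧ 0 ≤ u.1 ∧ u.2 ≤ u.1 := by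
  simp only [IsGlobalMinPt, familyGrA1A1, Sum.forall, Sum.elim_inl, Sum.elim_inr]
  constructor
  · rintro ⟨h₁, h₂, h₃⟩
    have hx : x = 0 := by nlinarith [h₂ 0]
    subst hx
    exact ⟨rfl, by linarith [h₁ 0], by linarith [h₃ 0]⟩
  · rintro ⟨rfl, h₁, h₂⟩
    refine ⟨fun y => ?_, fun y => ?_, fun y => ?_⟩ <;> nlinarith [sq_nonneg y]

/-- The analogue of `isGlobalMinPt_familyGrA1A1_inl` for the third branch. -/
theorem isGlobalMinPt_familyGrA1A1_inr_inr (u : ℝ × ℝ) (x : ℝ) :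
    IsGlobalMinPt familyGrA1A1 u (.inr (.inr x)) ↔ x = 0 ∧ |u.1| ≤ u.2 := by
  simp only [IsGlobalMinPt, familyGrA1A1, Sum.forall, Sum.elim_inl, Sum.elim_inr, abs_le]
  constructor
  · rintro ⟨h₁, h₂, h₃⟩
    have hx : x = 0 := by nlinarith [h₃ 0]
    subst hx
    exact ⟨rfl, by linarith [h₁ 0], by linarith [h₂ 0]⟩
  · rintro ⟨rfl, h₁, h₂⟩
    refine ⟨fun y => ?_, fun y => ?_, fun y => ?_⟩ <;> nlinarith [sq_nonneg y]

theorem stmt_8 :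
    MaxwellSet familyGrA1A1 =
      {u : ℝ × ℝ | u.1 = 0 ∧ u.2 < 0} ∪ {u : ℝ × ℝ | |u.1| = u.2} := by
  ext ⟨a, b⟩
  simp only [MaxwellSet, Set.mem_ofPred_eq, Set.mem_union, Sum.exists, ne_eq, Sum.inl.injEq,
    Sum.inr.injEq, reduceCtorEq, isGlobalMinPt_familyGrA1A1_inl,
    isGlobalMinPt_familyGrA1A1_inr_inl, isGlobalMinPt_familyGrA1A1_inr_inr]
  constructor
  · grind
  · rintro (⟨rfl, hb⟩ | rfl)
    · exact .inl ⟨0, .inr (.inl ⟨0, by grind⟩)⟩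
    · rcases le_total a 0 with ha | ha
      · exact .inl ⟨0, .inr (.inr ⟨0, by grind⟩)⟩
      · exact .inr (.inl ⟨0, .inr (.inr ⟨0, by grind⟩)⟩)
end

section
/- Consider the reflection-symmetric four-branch family G_r((A₁,A₁)): take the state space X = ℝ ⊕ ℝ ⊕ ℝ ⊕ ℝ (four copies of ℝ), parameter space U = ℝ² with coordinates (u_x,u_z), and F given on the four branches by x² + u_x, x² − u_x, x² + u_x + u_z, and x² − u_x + u_z, respectively. Then the Maxwell set of F equals {(u_x,u_z) : u_x = 0} ∪ {(u_x,u_z) : u_z = 0}. -/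
/-- The reflection-symmetric four-branch family `G_r((A₁, A₁))`:
`x² + u_x`, `x² − u_x`, `x² + u_x + u_z` and `x² − u_x + u_z` on the four
branches; parameters `(u_x, u_z)`. -/
noncomputable def familyGrA1A1pair : (ℝ ⊕ ℝ ⊕ ℝ ⊕ ℝ) × (ℝ × ℝ) → ℝ :=
  fun p =>
    Sum.elim (fun x : ℝ => x ^ 2 + p.2.1)
      (Sum.elim (fun x : ℝ => x ^ 2 - p.2.1)
        (Sum.elim (fun x : ℝ => x ^ 2 + p.2.1 + p.2.2)
          (fun x : ℝ => x ^ 2 - p.2.1 + p.2.2))) p.1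

theorem isGlobalMinPt_familyGrA1A1pair_iff (u : ℝ × ℝ) (x : ℝ ⊕ ℝ ⊕ ℝ ⊕ ℝ) :
    IsGlobalMinPt familyGrA1A1pair u x ↔
      familyGrA1A1pair (x, u) ≤ u.1 ∧ familyGrA1A1pair (x, u) ≤ -u.1 ∧
        familyGrA1A1pair (x, u) ≤ u.1 + u.2 ∧ familyGrA1A1pair (x, u) ≤ -u.1 + u.2 := by
  constructor
  · intro h
    have h₁ := h (.inl 0)
    have h₂ := h (.inr (.inl 0))
    have h₃ := h (.inr (.inr (.inl 0)))
    have h₄ := h (.inr (.inr (.inr 0)))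
    simp only [familyGrA1A1pair, Sum.elim_inl, Sum.elim_inr] at h₁ h₂ h₃ h₄ ⊢
    refine ⟨?_, ?_, ?_, ?_⟩ <;> linarith
  · rintro ⟨h₁, h₂, h₃, h₄⟩ (y | y | y | y)
    · exact h₁.trans (by simp only [familyGrA1A1pair, Sum.elim_inl]; linarith [sq_nonneg y])
    all_goals
      have hy := sq_nonneg y
      first
      | exact h₂.trans (by simp only [familyGrA1A1pair, Sum.elim_inl, Sum.elim_inr]; linarith)
      | exact h₃.trans (by simp only [familyGrA1A1pair, Sum.elim_inl, Sum.elim_inr]; linarith)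
      | exact h₄.trans (by simp only [familyGrA1A1pair, Sum.elim_inr]; linarith)

theorem stmt_9 :
    MaxwellSet familyGrA1A1pair =
      {u : ℝ × ℝ | u.1 = 0} ∪ {u : ℝ × ℝ | u.2 = 0} := by
  ext ⟨a, b⟩
  simp only [MaxwellSet, Set.mem_ofPred_eq, Set.mem_union, isGlobalMinPt_familyGrA1A1pair_iff]
  constructor
  · rintro ⟨x | x | x | x, y | y | y | y, hne, ⟨h₁, h₂, h₃, h₄⟩, k₁, k₂, k₃, k₄⟩
    all_goals
      simp only [familyGrA1A1pair, Sum.elim_inl, Sum.elim_inr] at h₁ h₂ h₃ h₄ k₁ k₂ k₃ k₄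
      have hx := sq_nonneg x
      have hy := sq_nonneg y
      first
      | exact Or.inl (by linarith)
      | exact Or.inr (by linarith)
      | obtain rfl : x = 0 := pow_eq_zero_iff two_ne_zero |>.mp (by linarith)
        obtain rfl : y = 0 := pow_eq_zero_iff two_ne_zero |>.mp (by linarith)
        exact absurd rfl hne
  · rintro (rfl | rfl)
    · rcases le_total 0 b with hb | hb
      · exact ⟨.inl 0, .inr (.inl 0), by simp, by simp [familyGrA1A1pair, hb],
          by simp [familyGrA1A1pair, hb]⟩
      · exact ⟨.inr (.inr (.inl 0)), .inr (.inr (.inr 0)), by simp,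
          by simp [familyGrA1A1pair, hb], by simp [familyGrA1A1pair, hb]⟩
    · rcases le_total 0 a with ha | ha
      · exact ⟨.inr (.inl 0), .inr (.inr (.inr 0)), by simp,
          by simp [familyGrA1A1pair, ha], by simp [familyGrA1A1pair, ha]⟩
      · exact ⟨.inl 0, .inr (.inr (.inl 0)), by simp,
          by simp [familyGrA1A1pair, ha], by simp [familyGrA1A1pair, ha]⟩
end

section
/- Consider the rotationally symmetric quartic family G_a(A₃): take the state space X = ℝ² (with Euclidean norm |·| and inner product ⟨·,·⟩), parameters (u,u_z) ∈ ℝ² × ℝ, and F(p,(u,u_z)) = |p|⁴ + u_z·|p|² + ⟨u,p⟩. Then F(·,(u,u_z)) has at least two distinct global minimum points on ℝ² if and only if u = 0 and u_z < 0. In particular, for u = 0 and u_z < 0 the set of global minimum points is the circle {p : |p|² = −u_z/2}, and for u ≠ 0 the global minimum point is unique. -/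
open scoped RealInnerProductSpace

/-- The rotationally symmetric quartic family `G_a(A₃)` on the Euclidean plane:
`F (p, (u, u_z)) = |p|⁴ + u_z·|p|² + ⟨u, p⟩`. -/
noncomputable def familyGaA3 :
    EuclideanSpace ℝ (Fin 2) × (EuclideanSpace ℝ (Fin 2) × ℝ) → ℝ :=
  fun q => ‖q.1‖ ^ 4 + q.2.2 * ‖q.1‖ ^ 2 + ⟪q.2.1, q.1⟫

theorem familyGaA3_apply (u p : EuclideanSpace ℝ (Fin 2)) (a : ℝ) :
    familyGaA3 (p, (u, a)) = ‖p‖ ^ 4 + a * ‖p‖ ^ 2 + ⟪u, p⟫ := rfl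

/-- The derivative of a quartic polynomial vanishes at a global minimum point. -/
theorem quartic_critical_of_forall_le {a n r : ℝ}
    (h : ∀ t : ℝ, r ^ 4 + a * r ^ 2 - n * r ≤ t ^ 4 + a * t ^ 2 - n * t) :
    4 * r ^ 3 + 2 * a * r - n = 0 := by
  have hd : HasDerivAt (fun t : ℝ => t ^ 4 + a * t ^ 2 - n * t)
      (4 * r ^ 3 + 2 * a * r - n) r := by
    refine (((hasDerivAt_pow 4 r).add ((hasDerivAt_pow 2 r).const_mul a)).sub
      ((hasDerivAt_id r).const_mul n)).congr_deriv ?_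
    norm_num
    ring
  exact IsLocalMin.hasDerivAt_eq_zero (Filter.Eventually.of_forall h) hd

/-- A quartic polynomial without cubic term has at most one nonnegative global minimum point. -/
theorem quartic_min_unique_of_nonneg {a n r s : ℝ} (hr : 0 ≤ r) (hs : 0 ≤ s)
    (h₁ : ∀ t : ℝ, r ^ 4 + a * r ^ 2 - n * r ≤ t ^ 4 + a * t ^ 2 - n * t)
    (h₂ : ∀ t : ℝ, s ^ 4 + a * s ^ 2 - n * s ≤ t ^ 4 + a * t ^ 2 - n * t) : r = s := by
  have hc₁ := quartic_critical_of_forall_le h₁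
  have hc₂ := quartic_critical_of_forall_le h₂
  have he := le_antisymm (h₁ s) (h₂ r)
  have key : (r + s) * (r - s) ^ 3 = 0 := by
    linear_combination (-1) * he + (r - s) / 2 * (hc₁ + hc₂)
  rcases mul_eq_zero.mp key with h | h
  · linarith
  · exact sub_eq_zero.mp (pow_eq_zero_iff (by norm_num) |>.mp h)

theorem familyGaA3_smul_direction {u : EuclideanSpace ℝ (Fin 2)} (hu : u ≠ 0) (a t : ℝ) :
    familyGaA3 ((-(t / ‖u‖)) • u, (u, a)) = t ^ 4 + a * t ^ 2 - ‖u‖ * t := by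
  have hn : ‖u‖ ≠ 0 := norm_ne_zero_iff.mpr hu
  have h : ‖(-(t / ‖u‖)) • u‖ = |t| := by
    rw [norm_smul, norm_neg, norm_div, norm_norm, Real.norm_eq_abs, div_mul_cancel₀ _ hn]
  rw [familyGaA3_apply, h, inner_smul_right, real_inner_self_eq_norm_sq, sq_abs,
    Even.pow_abs (by decide)]
  field_simp
  ring

/-- For `u ≠ 0`, a global minimum point is a nonpositive multiple of `u`. -/
theorem IsGlobalMinPt.eq_smul {u p : EuclideanSpace ℝ (Fin 2)} {a : ℝ} (hu : u ≠ 0)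
    (hp : IsGlobalMinPt familyGaA3 (u, a) p) : p = (-(‖p‖ / ‖u‖)) • u := by
  have hn : ‖u‖ ≠ 0 := norm_ne_zero_iff.mpr hu
  have h := hp ((-(‖p‖ / ‖u‖)) • u)
  rw [familyGaA3_smul_direction hu, familyGaA3_apply] at h
  have hcs : ⟪-u, p⟫ = ‖-u‖ * ‖p‖ := by
    apply le_antisymm (real_inner_le_norm _ _)
    rw [inner_neg_left, norm_neg]
    linarith
  rw [inner_eq_norm_mul_iff_real, norm_neg] at hcs
  rw [neg_smul, ← smul_neg, div_eq_inv_mul, mul_smul, hcs, inv_smul_smul₀ hn]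

theorem IsGlobalMinPt.quartic_norm_le {u p : EuclideanSpace ℝ (Fin 2)} {a : ℝ} (hu : u ≠ 0)
    (hp : IsGlobalMinPt familyGaA3 (u, a) p) (t : ℝ) :
    ‖p‖ ^ 4 + a * ‖p‖ ^ 2 - ‖u‖ * ‖p‖ ≤ t ^ 4 + a * t ^ 2 - ‖u‖ * t := by
  have h := hp ((-(t / ‖u‖)) • u)
  rwa [hp.eq_smul hu, familyGaA3_smul_direction hu, familyGaA3_smul_direction hu] at h

theorem IsGlobalMinPt.unique {u p q : EuclideanSpace ℝ (Fin 2)} {a : ℝ} (hu : u ≠ 0)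
    (hp : IsGlobalMinPt familyGaA3 (u, a) p) (hq : IsGlobalMinPt familyGaA3 (u, a) q) :
    p = q := by
  rw [hp.eq_smul hu, hq.eq_smul hu, quartic_min_unique_of_nonneg (norm_nonneg p) (norm_nonneg q)
    (hp.quartic_norm_le hu) (hq.quartic_norm_le hu)]

theorem exists_isGlobalMinPt_familyGaA3 (u : EuclideanSpace ℝ (Fin 2)) (a : ℝ) :
    ∃ p, IsGlobalMinPt familyGaA3 (u, a) p := by
  have hc : Continuous fun p => familyGaA3 (p, (u, a)) := by
    simp only [familyGaA3_apply]
    fun_prop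
  refine hc.exists_forall_le' 0 ?_
  filter_upwards [(tendsto_norm_cocompact_atTop
    (E := EuclideanSpace ℝ (Fin 2))).eventually_ge_atTop (1 + |a| + ‖u‖)] with p hp
  rw [familyGaA3_apply, familyGaA3_apply]
  have hin := neg_le_of_abs_le (abs_real_inner_le_norm u p)
  have ha := neg_abs_le a
  have ha₀ := abs_nonneg a
  have hu₀ := norm_nonneg u
  have hp₁ : 1 ≤ ‖p‖ := by linarith
  have hsq : |a| + ‖u‖ ≤ ‖p‖ ^ 2 := by nlinarith
  have h₁ : (|a| + ‖u‖) * ‖p‖ ^ 2 ≤ ‖p‖ ^ 2 * ‖p‖ ^ 2 := by gcongr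
  have h₂ : -|a| * ‖p‖ ^ 2 ≤ a * ‖p‖ ^ 2 := by gcongr
  have h₃ : ‖u‖ * ‖p‖ ≤ ‖u‖ * ‖p‖ ^ 2 := by
    gcongr
    nlinarith
  simp only [norm_zero, inner_zero_right]
  nlinarith

theorem isGlobalMinPt_familyGaA3_zero_iff {a : ℝ} (ha : a < 0) (p : EuclideanSpace ℝ (Fin 2)) :
    IsGlobalMinPt familyGaA3 (0, a) p ↔ ‖p‖ ^ 2 = -a / 2 := by
  simp only [IsGlobalMinPt, familyGaA3_apply, inner_zero_left, add_zero]
  constructor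
  · intro h
    obtain ⟨q, hq⟩ := exists_norm_eq (EuclideanSpace ℝ (Fin 2)) (Real.sqrt_nonneg (-a / 2))
    have hq₂ : ‖q‖ ^ 2 = -a / 2 := by rw [hq, Real.sq_sqrt (by linarith)]
    have hle := h q
    rw [show ‖q‖ ^ 4 = (‖q‖ ^ 2) ^ 2 by ring, hq₂] at hle
    have hz : (‖p‖ ^ 2 + a / 2) ^ 2 = 0 := le_antisymm (by nlinarith) (sq_nonneg _)
    linarith [pow_eq_zero_iff (two_ne_zero) |>.mp hz]
  · intro h q
    rw [show ‖p‖ ^ 4 = (‖p‖ ^ 2) ^ 2 by ring, h]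
    nlinarith [sq_nonneg (‖q‖ ^ 2 + a / 2)]

theorem IsGlobalMinPt.eq_zero {a : ℝ} (ha : 0 ≤ a) {p : EuclideanSpace ℝ (Fin 2)}
    (hp : IsGlobalMinPt familyGaA3 (0, a) p) : p = 0 := by
  have h := hp 0
  simp only [familyGaA3_apply, inner_zero_left, norm_zero] at h
  have h₁ : 0 ≤ a * ‖p‖ ^ 2 := by positivity
  have h₂ : ‖p‖ ^ 4 = 0 := le_antisymm (by linarith) (by positivity)
  exact norm_eq_zero.mp (pow_eq_zero_iff (by norm_num) |>.mp h₂)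

theorem stmt_12 :
    (∀ u : EuclideanSpace ℝ (Fin 2), ∀ uz : ℝ,
      ((∃ p₁ p₂ : EuclideanSpace ℝ (Fin 2), p₁ ≠ p₂ ∧
          IsGlobalMinPt familyGaA3 (u, uz) p₁ ∧ IsGlobalMinPt familyGaA3 (u, uz) p₂) ↔
        u = 0 ∧ uz < 0)) ∧
    (∀ uz : ℝ, uz < 0 →
      {p : EuclideanSpace ℝ (Fin 2) | IsGlobalMinPt familyGaA3 (0, uz) p} =
        {p : EuclideanSpace ℝ (Fin 2) | ‖p‖ ^ 2 = -uz / 2}) ∧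
    (∀ u : EuclideanSpace ℝ (Fin 2), ∀ uz : ℝ, u ≠ 0 →
      ∃! p : EuclideanSpace ℝ (Fin 2), IsGlobalMinPt familyGaA3 (u, uz) p) := by
  refine ⟨fun u a => ⟨?_, ?_⟩, fun a ha => Set.ext (isGlobalMinPt_familyGaA3_zero_iff ha),
    fun u a hu => ?_⟩
  · rintro ⟨p, q, hne, hp, hq⟩
    have hu : u = 0 := by
      by_contra hu
      exact hne (hp.unique hu hq)
    subst hu
    refine ⟨rfl, ?_⟩
    by_contra! ha
    exact hne ((hp.eq_zero ha).trans (hq.eq_zero ha).symm)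
  · rintro ⟨rfl, ha⟩
    obtain ⟨p, hp⟩ := exists_isGlobalMinPt_familyGaA3 0 a
    have hnorm := (isGlobalMinPt_familyGaA3_zero_iff ha p).mp hp
    refine ⟨p, -p, fun h => ?_, hp, ?_⟩
    · have h₂ : (2 : ℝ) • p = 0 := by
        rw [two_smul]
        exact eq_neg_iff_add_eq_zero.mp h
      rw [(smul_eq_zero_iff_right two_ne_zero).mp h₂, norm_zero] at hnorm
      linarith
    · rwa [isGlobalMinPt_familyGaA3_zero_iff ha, norm_neg]
  · obtain ⟨p, hp⟩ := exists_isGlobalMinPt_familyGaA3 u a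
    exact ⟨p, hp, fun q hq => hq.unique hu hp⟩
end

section
/- Consider the axially symmetric two-branch family (G_a(A₁),A₁): take the state space X = (ℝ × (ℝ/2πℤ)) ⊕ ℝ² (a branch with a real variable z and an angle θ, and a branch of points p ∈ ℝ² with Euclidean norm), parameter space U = ℝ³ with coordinates (u_r,u_z,u_θ), and F given by F(inl(z,θ),u) = z² + u_r·cos(θ − u_θ) on the first branch and F(inr p, u) = |p|² + u_z on the second branch. Then the Maxwell set of F equals {(u_r,u_z,u_θ) : u_r = 0 and u_z ≥ 0} ∪ {(u_r,u_z,u_θ) : u_z = −|u_r|}. -/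
/-- The axially symmetric two-branch family `(G_a(A₁), A₁)`: the first branch
has state `(z, θ)` with `θ` an angle on the circle `ℝ/2πℤ` and value
`z² + u_r · cos (θ − u_θ)`; the second branch has state `p ∈ ℝ²` (Euclidean)
and value `|p|² + u_z`. Parameters are `(u_r, u_z, u_θ)`. -/
noncomputable def familyGaA1A1 :
    ((ℝ × Real.Angle) ⊕ EuclideanSpace ℝ (Fin 2)) × (ℝ × ℝ × ℝ) → ℝ :=
  fun p =>
    Sum.elim
      (fun q : ℝ × Real.Angle =>
        q.1 ^ 2 + p.2.1 * Real.Angle.cos (q.2 - (p.2.2.2 : Real.Angle)))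
      (fun q : EuclideanSpace ℝ (Fin 2) => ‖q‖ ^ 2 + p.2.2.1) p.1

theorem neg_abs_le_mul_angle_cos (r : ℝ) (φ : Real.Angle) : -|r| ≤ r * φ.cos := by
  induction φ using Real.Angle.induction_on with
  | h x =>
    rw [Real.Angle.cos_coe]
    refine neg_le_of_neg_le ((neg_le_abs _).trans ?_)
    rw [abs_mul]
    exact mul_le_of_le_one_right (abs_nonneg r) (Real.abs_cos_le_one x)

theorem exists_mul_angle_cos_eq_neg_abs (r : ℝ) :
    ∃ α : Real.Angle, r * α.cos = -|r| ∧
      (r ≠ 0 → ∀ φ : Real.Angle, r * φ.cos ≤ -|r| → φ = α) := by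
  obtain ⟨α, hα, hneg⟩ : ∃ α : Real.Angle, r * α.cos = -|r| ∧ -α = α := by
    rcases le_total 0 r with hr | hr
    · exact ⟨(Real.pi : Real.Angle), by simp [abs_of_nonneg hr], Real.Angle.neg_coe_pi⟩
    · exact ⟨0, by simp [abs_of_nonpos hr], neg_zero⟩
  refine ⟨α, hα, fun hr φ hφ => ?_⟩
  have hcos : φ.cos = α.cos :=
    mul_left_cancel₀ hr ((hφ.antisymm (neg_abs_le_mul_angle_cos r φ)).trans hα.symm)
  rcases Real.Angle.cos_eq_iff_eq_or_eq_neg.mp hcos with h | h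
  · exact h
  · rw [h, hneg]

theorem stmt_13 :
    MaxwellSet familyGaA1A1 =
      {u : ℝ × ℝ × ℝ | u.1 = 0 ∧ 0 ≤ u.2.1} ∪
        {u : ℝ × ℝ × ℝ | u.2.1 = -|u.1|} := by
  ext ⟨r, s, t⟩
  obtain ⟨α, hα, huniq⟩ := exists_mul_angle_cos_eq_neg_abs r
  have hbound := neg_abs_le_mul_angle_cos r
  have isMin_inl (z : ℝ) (θ : Real.Angle)
      (h : IsGlobalMinPt familyGaA1A1 (r, s, t) (Sum.inl (z, θ))) :
      z = 0 ∧ r * (θ - t).cos ≤ -|r| ∧ -|r| ≤ s := by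
    have h₁ := h (Sum.inl (0, α + t))
    have h₂ := h (Sum.inr 0)
    simp only [familyGaA1A1, Sum.elim_inl, Sum.elim_inr, add_sub_cancel_right, hα,
      norm_zero] at h₁ h₂
    have h₃ := hbound (θ - t)
    exact ⟨by nlinarith, by nlinarith, by nlinarith⟩
  have isMin_inr (p : EuclideanSpace ℝ (Fin 2))
      (h : IsGlobalMinPt familyGaA1A1 (r, s, t) (Sum.inr p)) : p = 0 ∧ s ≤ -|r| := by
    have h₁ := h (Sum.inl (0, α + t))
    have h₂ := h (Sum.inr 0)
    simp only [familyGaA1A1, Sum.elim_inl, Sum.elim_inr, add_sub_cancel_right, hα,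
      norm_zero] at h₁ h₂
    exact ⟨norm_eq_zero.mp (by nlinarith), by nlinarith [sq_nonneg ‖p‖]⟩
  simp only [MaxwellSet, Set.mem_union, Set.mem_ofPred_eq]
  constructor
  · rintro ⟨⟨z₁, θ₁⟩ | p₁, ⟨z₂, θ₂⟩ | p₂, hne, h₁, h₂⟩
    · obtain ⟨rfl, hθ₁, hs⟩ := isMin_inl _ _ h₁
      obtain ⟨rfl, hθ₂, -⟩ := isMin_inl _ _ h₂
      have hr : r = 0 := by
        by_contra hr
        refine hne ?_
        rw [sub_left_injective ((huniq hr _ hθ₁).trans (huniq hr _ hθ₂).symm)]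
      exact Or.inl ⟨hr, by simpa [hr] using hs⟩
    · exact Or.inr ((isMin_inr _ h₂).2.antisymm (isMin_inl _ _ h₁).2.2)
    · exact Or.inr ((isMin_inr _ h₁).2.antisymm (isMin_inl _ _ h₂).2.2)
    · rw [(isMin_inr _ h₁).1, (isMin_inr _ h₂).1] at hne
      exact absurd rfl hne
  · rintro (⟨rfl, hs⟩ | rfl)
    · have hmin (θ : Real.Angle) :
          IsGlobalMinPt familyGaA1A1 (0, s, t) (Sum.inl (0, θ)) := by
        rintro (⟨z, φ⟩ | p) <;> simp [familyGaA1A1] <;> positivity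
      refine ⟨Sum.inl (0, 0), Sum.inl (0, (Real.pi : Real.Angle)), ?_, hmin _, hmin _⟩
      simpa using Real.Angle.pi_ne_zero.symm
    · refine ⟨Sum.inl (0, α + t), Sum.inr 0, Sum.inl_ne_inr, ?_, ?_⟩ <;>
        rintro (⟨z, φ⟩ | p) <;>
        simp only [familyGaA1A1, Sum.elim_inl, Sum.elim_inr, add_sub_cancel_right, hα, norm_zero]
      · nlinarith [hbound (φ - t), sq_nonneg z]
      · nlinarith [sq_nonneg ‖p‖]
      · nlinarith [hbound (φ - t), sq_nonneg z]
      · nlinarith [sq_nonneg ‖p‖]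
end
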